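/- For fixed d ≥ 1, the expected number of interior generators after n i.i.d. uniform d-dimensional observations satisfies E ι_{d,n} = (ln n)^{d-1} Σ_{j=0}^{d-1} [(-1)^j Γ^{(j)}(d)/(j!(d-1-j)!)](ln n)^{-j} + O(n^{-1}(ln n)^{d-1}) as n → ∞; in particular E ι_{d,n} and (hence) the expected total number of generators E γ_{d,n} satisfy E γ_{d,n} = (ln n)^{d-1} + O((ln n)^{d-2}). -/

import Mathlib

open MeasureTheory Filter Asymptotics Set

/-- Expected number of interior generators after `n` i.i.d. uniform observations in
dimension `k`: `E ι_{k,n} = n^{\underline k} ∫_{(0,1]^k} x_×^{k-1}(1-x_×)^{n-k} dx`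
for `k ≥ 1`, with the convention `ι_{0,n} = δ_{0,n}`. -/
noncomputable def Eiota (k n : ℕ) : ℝ :=
  if k = 0 then (if n = 0 then 1 else 0)
  else
    (n.descFactorial k : ℝ) *
      ∫ x in Set.univ.pi fun _ : Fin k => Set.Ioc (0 : ℝ) 1,
        (∏ j, x j) ^ (k - 1) * (1 - ∏ j, x j) ^ (n - k)

/-- Expected total number of generators: `E γ_{d,n} = ∑_{k=0}^d C(d,k) E ι_{k,n}`. -/
noncomputable def Egamma (d n : ℕ) : ℝ :=
  ∑ k ∈ Finset.range (d + 1), (d.choose k : ℝ) * Eiota k n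

noncomputable def logExpC (j : ℕ) : ℝ → ℂ := fun t => (((Real.log t)^j * Real.exp (-t) : ℝ) : ℂ)

lemma GL_succ (j : ℕ) : logExpC (j+1) = fun t => Real.log t • logExpC j t := by
  funext t
  simp [logExpC, pow_succ]; ring

lemma GL_loc (j : ℕ) : LocallyIntegrableOn (logExpC j) (Ioi 0) := by
  apply ContinuousOn.locallyIntegrableOn _ measurableSet_Ioi
  unfold logExpC
  apply Complex.continuous_ofReal.comp_continuousOn
  apply ContinuousOn.mul
  · apply ContinuousOn.pow
    exact Real.continuousOn_log.mono (fun x hx => ne_of_gt hx)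
  · fun_prop

lemma GL_top (j : ℕ) : ∀ a : ℝ, logExpC j =O[atTop] (fun t : ℝ => t ^ (-a)) := by
  induction j with
  | zero =>
    intro a
    have := (isLittleO_exp_neg_mul_rpow_atTop one_pos (-a)).isBigO
    refine (IsBigO.of_norm_left (this.norm_left.congr_left fun t => ?_))
    rw [logExpC, Complex.norm_real]; simp
  | succ j ih =>
    intro a
    rw [GL_succ]
    exact isBigO_rpow_top_log_smul (lt_add_one a) (ih (a+1))

lemma GL_bot (j : ℕ) : ∀ b : ℝ, 0 < b → logExpC j =O[nhdsWithin 0 (Ioi 0)] (fun t : ℝ => t ^ (-b)) := by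
  induction j with
  | zero =>
    intro b hb
    apply IsBigO.of_bound 1
    filter_upwards [Ioc_mem_nhdsGT (zero_lt_one (α := ℝ))] with t ht
    rw [logExpC, Complex.norm_real, Real.norm_of_nonneg (by positivity), Real.norm_of_nonneg (Real.rpow_nonneg ht.1.le _)]
    have h1 : Real.exp (-t) ≤ 1 := Real.exp_le_one_iff.2 (by linarith [ht.1])
    have h2 : 1 ≤ t ^ (-b) := Real.one_le_rpow_of_pos_of_le_one_of_nonpos ht.1 ht.2 (by linarith)
    simpa using h1.trans h2
  | succ j ih =>
    intro b hb
    rw [GL_succ]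
    exact isBigO_rpow_zero_log_smul (half_lt_self hb) (ih (b/2) (half_pos hb))

lemma GL_conv (j : ℕ) (s : ℂ) (hs : 0 < s.re) : MellinConvergent (logExpC j) s :=
  mellinConvergent_of_isBigO_rpow (GL_loc j) (GL_top j (s.re+1)) (lt_add_one _)
    (GL_bot j (s.re/2) (half_pos hs)) (half_lt_self hs)

lemma GL_deriv (j : ℕ) (s : ℂ) (hs : 0 < s.re) :
    HasDerivAt (mellin (logExpC j)) (mellin (logExpC (j+1)) s) s := by
  rw [GL_succ]
  exact (mellin_hasDerivAt_of_isBigO_rpow (GL_loc j) (GL_top j (s.re+1)) (lt_add_one _)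
    (GL_bot j (s.re/2) (half_pos hs)) (half_lt_self hs)).2

lemma iter_Gamma (j : ℕ) : ∀ x : ℝ, 0 < x →
    iteratedDeriv j Real.Gamma x = (mellin (logExpC j) (x : ℂ)).re := by
  induction j with
  | zero =>
    intro x hx
    have h := Complex.Gamma_eq_integral (s := (x:ℂ)) (by simpa using hx)
    rw [Complex.GammaIntegral_eq_mellin] at h
    rw [iteratedDeriv_zero, Real.Gamma, h]
    congr 2
    funext t; simp [logExpC]
  | succ j ih =>
    intro x hx
    rw [iteratedDeriv_succ]
    have h1 : iteratedDeriv j Real.Gamma =ᶠ[nhds x] fun y : ℝ => (mellin (logExpC j) (y : ℂ)).re := by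
      filter_upwards [Ioi_mem_nhds hx] with y hy using ih y hy
    rw [h1.deriv_eq]
    exact (GL_deriv j (x:ℂ) (by simpa using hx)).real_of_complex.deriv

lemma GL_pow (j m : ℕ) (t : ℝ) :
    (t : ℂ) ^ (((m + 1 : ℕ) : ℂ) - 1) • logExpC j t
      = ((t ^ m * (Real.log t)^j * Real.exp (-t) : ℝ) : ℂ) := by
  have : (((m + 1 : ℕ) : ℂ) - 1) = (m : ℂ) := by push_cast; ring
  rw [this, Complex.cpow_natCast, logExpC]
  push_cast; simp only [smul_eq_mul]; ring

lemma int_log (j m : ℕ) :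
    IntegrableOn (fun t : ℝ => t ^ m * (Real.log t)^j * Real.exp (-t)) (Ioi 0) := by
  have h := GL_conv j ((m+1 : ℕ) : ℂ) (by simp; positivity)
  unfold MellinConvergent at h
  simp only [GL_pow] at h
  have h2 := h.re
  simp only [RCLike.re_to_complex, Complex.ofReal_re] at h2
  exact h2

lemma Gamma_iter (j m : ℕ) : iteratedDeriv j Real.Gamma ((m + 1 : ℕ) : ℝ) =
    ∫ t in Ioi (0:ℝ), t ^ m * (Real.log t)^j * Real.exp (-t) := by
  rw [iter_Gamma j _ (by positivity), mellin]
  simp only [Complex.ofReal_natCast, GL_pow]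
  rw [integral_complex_ofReal, Complex.ofReal_re]

lemma image_exp_neg : (fun v : ℝ => Real.exp (-v)) '' Ioi 0 = Ioo 0 1 := by
  ext u
  constructor
  · rintro ⟨v, hv, rfl⟩
    exact ⟨Real.exp_pos _, by simpa using hv⟩
  · rintro ⟨h0, h1⟩
    exact ⟨-Real.log u, by simpa using Real.log_neg h0 h1, by simp [Real.exp_log h0]⟩

lemma mono_integral (m p : ℕ) :
    ∫ u in Ioo (0:ℝ) 1, u ^ m * (-Real.log u) ^ p = (p.factorial : ℝ) / ((m:ℝ) + 1) ^ (p + 1) := by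
  rw [← image_exp_neg, integral_image_eq_integral_abs_deriv_smul measurableSet_Ioi
    (f' := fun v => -Real.exp (-v))]
  · have h := Real.integral_rpow_mul_exp_neg_mul_Ioi (a := (p:ℝ) + 1) (r := (m:ℝ) + 1)
      (by positivity) (by positivity)
    rw [Real.Gamma_nat_eq_factorial] at h
    have e : (p.factorial : ℝ) / ((m:ℝ) + 1) ^ (p + 1)
      = (1 / ((m:ℝ) + 1)) ^ ((p:ℝ) + 1) * (p.factorial : ℝ) := by
      have : ((p:ℝ) + 1) = ((p + 1 : ℕ) : ℝ) := by push_cast; ring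
      rw [this, Real.rpow_natCast, one_div, inv_pow]
      field_simp
    rw [e, ← h]
    refine setIntegral_congr_fun measurableSet_Ioi fun v hv => ?_
    simp only [smul_eq_mul, abs_neg, Real.abs_exp, Real.log_exp, neg_neg, add_sub_cancel_right,
      Real.rpow_natCast]
    rw [← Real.exp_nat_mul]
    have : Real.exp (-(((m:ℝ) + 1) * v)) = Real.exp (-v) * Real.exp (m * -v) := by
      rw [← Real.exp_add]; ring_nf
    rw [this]; ring
  · intro x _
    have := ((hasDerivAt_id x).neg.exp).hasDerivWithinAt (s := Ioi 0)
    simpa using! this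
  · intro x _ y _ h
    simpa using h

lemma mono_integrable (m p : ℕ) :
    IntegrableOn (fun u : ℝ => u ^ m * (-Real.log u) ^ p) (Ioo (0:ℝ) 1) := by
  by_contra h
  have h1 := integral_undef h
  rw [mono_integral] at h1
  have : (0:ℝ) < (p.factorial : ℝ) / ((m:ℝ) + 1) ^ (p + 1) := by positivity
  linarith

lemma cube_integrable (k m : ℕ) :
    IntegrableOn (fun x : Fin k → ℝ => (∏ j, x j) ^ m)
      (Set.univ.pi fun _ : Fin k => Set.Ioc (0 : ℝ) 1) := by
  rw [IntegrableOn, volume_pi, Measure.restrict_pi_pi]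
  simp_rw [← Finset.prod_pow]
  apply Integrable.fintype_prod (f := fun _ (y:ℝ) => y ^ m)
  intro i
  exact ((continuous_pow m).integrableOn_Icc (a := 0) (b := 1)).mono_set Ioc_subset_Icc_self

lemma cube_integral (k m : ℕ) :
    ∫ x in (Set.univ.pi fun _ : Fin k => Set.Ioc (0 : ℝ) 1), (∏ j, x j) ^ m
      = 1 / ((m:ℝ) + 1) ^ k := by
  rw [volume_pi, Measure.restrict_pi_pi]
  simp_rw [← Finset.prod_pow]
  rw [integral_fintype_prod_eq_pow (fun y : ℝ => y ^ m), ← intervalIntegral.integral_of_le zero_le_one,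
    integral_pow]
  simp

lemma expand_poly (p N : ℕ) (u : ℝ) : u ^ p * (1 - u) ^ N =
    ∑ i ∈ Finset.range (N + 1), ((-1 : ℝ) ^ i * (N.choose i : ℝ)) * u ^ (p + i) := by
  have : (1 - u) = -u + 1 := by ring
  rw [this, add_pow, Finset.mul_sum]
  refine Finset.sum_congr rfl fun i _ => ?_
  rw [neg_pow u i, pow_add]; ring

lemma cube_to_line (p N : ℕ) :
    ∫ x in (Set.univ.pi fun _ : Fin (p+1) => Set.Ioc (0 : ℝ) 1),
        (∏ j, x j) ^ p * (1 - ∏ j, x j) ^ N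
      = (p.factorial : ℝ)⁻¹ * ∫ u in Ioo (0:ℝ) 1, u ^ p * (1 - u) ^ N * (-Real.log u) ^ p := by
  simp_rw [expand_poly p N, Finset.sum_mul, mul_assoc]
  rw [integral_finsetSum _ fun i _ => ((cube_integrable (p+1) (p+i)).const_mul _).const_mul _,
    integral_finsetSum _ fun i _ => ((mono_integrable (p+i) p).const_mul _).const_mul _,
    Finset.mul_sum]
  refine Finset.sum_congr rfl fun i _ => ?_
  simp_rw [integral_const_mul]
  rw [cube_integral, mono_integral]
  have : (p.factorial : ℝ) ≠ 0 := by positivity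
  field_simp

lemma line_integrable (p N : ℕ) :
    IntegrableOn (fun u : ℝ => u ^ p * (1 - u) ^ N * (-Real.log u) ^ p) (Ioo (0:ℝ) 1) := by
  simp_rw [expand_poly p N, Finset.sum_mul, mul_assoc]
  exact integrable_finsetSum _ fun i _ => ((mono_integrable (p+i) p).const_mul _).const_mul _

noncomputable def gcut (n N : ℕ) (t : ℝ) : ℝ := if t < n then (1 - t / n) ^ N else 0

lemma scale_fun (n N p : ℕ) (hn : 1 ≤ n) (t : ℝ) (ht : 0 < t) :
    t ^ p * gcut n N t * (Real.log n - Real.log t) ^ p = (n:ℝ) ^ p *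
      (Ioo (0:ℝ) 1).indicator (fun u : ℝ => u ^ p * (1 - u) ^ N * (-Real.log u) ^ p)
        ((n:ℝ)⁻¹ * t) := by
  have hn' : (0:ℝ) < n := by exact_mod_cast hn
  unfold gcut
  by_cases h : t < n
  · have hm : (n:ℝ)⁻¹ * t ∈ Ioo (0:ℝ) 1 := by
      refine ⟨by positivity, ?_⟩
      rw [inv_mul_lt_iff₀ hn']; simpa using h
    rw [if_pos h, indicator_of_mem hm, Real.log_mul (by positivity) ht.ne', Real.log_inv, mul_pow,
      inv_pow]
    have : -(-Real.log n + Real.log t) = Real.log n - Real.log t := by ring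
    rw [this, inv_mul_eq_div (n:ℝ) t]
    field_simp
  · have hm : (n:ℝ)⁻¹ * t ∉ Ioo (0:ℝ) 1 := by
      rintro ⟨_, h2⟩
      rw [inv_mul_lt_iff₀ hn'] at h2
      exact h (by simpa using h2)
    rw [if_neg h, indicator_of_notMem hm]; simp

lemma Ioi_inter_aux : Ioi (0:ℝ) ∩ Ioo 0 1 = Ioo 0 1 :=
  inter_eq_right.2 fun _ hx => hx.1

lemma scale_integrable (n N p : ℕ) (hn : 1 ≤ n) :
    IntegrableOn (fun t : ℝ => t ^ p * gcut n N t * (Real.log n - Real.log t) ^ p) (Ioi 0) := by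
  have hn' : (0:ℝ) < n := by exact_mod_cast hn
  refine IntegrableOn.congr_fun ?_ (fun t (ht : t ∈ Ioi (0:ℝ)) => (scale_fun n N p hn t ht).symm) measurableSet_Ioi
  apply Integrable.const_mul
  have := (integrableOn_Ioi_comp_mul_left_iff
    ((Ioo (0:ℝ) 1).indicator (fun u : ℝ => u ^ p * (1 - u) ^ N * (-Real.log u) ^ p)) 0
    (inv_pos.2 hn')).2
  apply this
  rw [mul_zero]
  exact ((integrable_indicator_iff measurableSet_Ioo).2 (line_integrable p N)).integrableOn

lemma scale_integral (n N p : ℕ) (hn : 1 ≤ n) :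
    ∫ t in Ioi (0:ℝ), t ^ p * gcut n N t * (Real.log n - Real.log t) ^ p =
      (n:ℝ) ^ (p+1) * ∫ u in Ioo (0:ℝ) 1, u ^ p * (1 - u) ^ N * (-Real.log u) ^ p := by
  have hn' : (0:ℝ) < n := by exact_mod_cast hn
  rw [setIntegral_congr_fun measurableSet_Ioi (fun t ht => scale_fun n N p hn t ht),
    integral_const_mul, integral_comp_mul_left_Ioi _ _ (inv_pos.2 hn'), mul_zero,
    setIntegral_indicator measurableSet_Ioo, Ioi_inter_aux, inv_inv, smul_eq_mul]
  ring

lemma gcut_bound (d n : ℕ) (hd : 1 ≤ d) (hn : d ≤ n) (t : ℝ) (ht : 0 < t) :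
    |gcut n (n - d) t - Real.exp (-t)| ≤
      Real.exp (-t) * ((d * Real.exp d) * t + t ^ 2) / n := by
  have hn1 : 1 ≤ n := hd.trans hn
  have hn' : (0:ℝ) < n := by exact_mod_cast hn1
  have hd' : (1:ℝ) ≤ d := by exact_mod_cast hd
  have hE := Real.exp_pos (-t)
  have hC : 1 ≤ d * Real.exp d := by
    have := Real.one_le_exp (x := (d:ℝ)) (by linarith)
    nlinarith
  unfold gcut
  by_cases h : t < n
  · rw [if_pos h]
    set u := t / n with hu
    have hu0 : 0 < u := by positivity
    have hu1 : u < 1 := by rw [hu, div_lt_one hn']; exact h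
    have htu : t = n * u := by rw [hu]; field_simp
    have up : (1 - u) ^ (n - d) ≤ Real.exp (-t) * (1 + d * Real.exp d * u) := by
      have h1 : (1 - u) ^ (n - d) ≤ (Real.exp (-u)) ^ (n - d) :=
        pow_le_pow_left₀ (by linarith) (by linarith [Real.add_one_le_exp (-u)]) _
      have h2 : (Real.exp (-u)) ^ (n - d) = Real.exp (-t) * Real.exp (d * u) := by
        rw [← Real.exp_nat_mul, ← Real.exp_add, Nat.cast_sub hn, htu]; ring_nf
      have h3 : Real.exp (d * u) ≤ 1 + d * Real.exp d * u := by
        have a1 := Real.add_one_le_exp (-(d * u))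
        have a2 : Real.exp (d*u) * Real.exp (-(d*u)) = 1 := by rw [← Real.exp_add]; simp
        have a3 : Real.exp (d*u) ≤ Real.exp d := Real.exp_le_exp.2 (by nlinarith)
        have a4 := Real.exp_pos (d*u)
        have a5 : 0 ≤ d * u := by positivity
        nlinarith
      rw [h2] at h1
      exact h1.trans (mul_le_mul_of_nonneg_left h3 hE.le)
    have lo : Real.exp (-t) * (1 - n * u ^ 2) ≤ (1 - u) ^ (n - d) := by
      have h1 : (1 - u) ^ n ≤ (1 - u) ^ (n - d) :=
        pow_le_pow_of_le_one (by linarith) (by linarith) (Nat.sub_le _ _)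
      have h2 : Real.exp (-u) * (1 - u^2) ≤ 1 - u := by
        have a1 := Real.add_one_le_exp u
        have a2 : Real.exp u * Real.exp (-u) = 1 := by rw [← Real.exp_add]; simp
        have a3 : Real.exp (-u) * (1 + u) ≤ 1 := by nlinarith [Real.exp_pos (-u)]
        nlinarith
      have h3 : (Real.exp (-u) * (1 - u^2)) ^ n ≤ (1 - u) ^ n :=
        pow_le_pow_left₀ (mul_nonneg (Real.exp_pos _).le (by nlinarith)) h2 _
      have h4 : Real.exp (-u) ^ n = Real.exp (-t) := by
        rw [← Real.exp_nat_mul, htu]; ring_nf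
      have h5 : 1 + n * (-u^2) ≤ (1 + -u^2) ^ n :=
        one_add_mul_le_pow (by nlinarith) n
      rw [mul_pow, h4] at h3
      have h6 : 1 - n * u^2 ≤ (1 - u^2)^n := by
        convert h5 using 1 <;> ring
      exact (mul_le_mul_of_nonneg_left h6 hE.le).trans (h3.trans h1)
    have e : Real.exp (-t) * ((d * Real.exp d) * t + t ^ 2) / n =
        Real.exp (-t) * (d * Real.exp d * u) + Real.exp (-t) * (n * u ^ 2) := by
      rw [hu]; field_simp
    rw [e, abs_le]
    have p1 : 0 ≤ Real.exp (-t) * (d * Real.exp d * u) := by positivity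
    have p2 : 0 ≤ Real.exp (-t) * (n * u ^ 2) := by positivity
    constructor <;> nlinarith
  · rw [if_neg h, zero_sub, abs_neg, abs_of_pos hE, le_div_iff₀ hn']
    push Not at h
    apply mul_le_mul_of_nonneg_left _ hE.le
    nlinarith [sq_nonneg t]

lemma desc_bound (d n : ℕ) (hd : 1 ≤ d) (hn : d ≤ n) :
    |(n.descFactorial d : ℝ) / (n:ℝ) ^ d - 1| ≤ (d:ℝ)^2 / n := by
  have hn1 : 1 ≤ n := hd.trans hn
  have hn' : (0:ℝ) < n := by exact_mod_cast hn1
  have up : (n.descFactorial d : ℝ) ≤ (n:ℝ)^d := by exact_mod_cast Nat.descFactorial_le_pow n d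
  have lo : ((n:ℝ) - d)^d ≤ (n.descFactorial d : ℝ) := by
    have h := Nat.pow_sub_le_descFactorial n d
    have h2 : (n - d)^d ≤ n.descFactorial d := (Nat.pow_le_pow_left (by omega) d).trans h
    rw [← Nat.cast_sub hn]
    exact_mod_cast h2
  have hdn : (d:ℝ) / n ≤ 1 := by rw [div_le_one hn']; exact_mod_cast hn
  have be := one_add_mul_le_pow (a := -((d:ℝ)/n)) (by linarith) d
  have e : (1 + -((d:ℝ)/n))^d = ((n:ℝ) - d)^d / (n:ℝ)^d := by
    rw [← div_pow]; congr 1; field_simp; ring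
  rw [e] at be
  have h1 : (n.descFactorial d : ℝ) / (n:ℝ) ^ d ≤ 1 := by rw [div_le_one (by positivity)]; exact up
  have h2 : ((n:ℝ) - d)^d / (n:ℝ)^d ≤ (n.descFactorial d : ℝ) / (n:ℝ) ^ d := by gcongr
  have e2 : (d:ℝ)^2/n = d * (d/n) := by ring
  have : 0 ≤ (d:ℝ)^2/n := by positivity
  rw [abs_le, e2] at *
  constructor <;> linarith

lemma main_expand (L : ℝ) (p : ℕ) (t : ℝ) : t ^ p * Real.exp (-t) * (L - Real.log t) ^ p =
    ∑ j ∈ Finset.range (p+1), ((-1 : ℝ) ^ j * (p.choose j : ℝ) * L ^ (p - j)) *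
      (t ^ p * (Real.log t)^j * Real.exp (-t)) := by
  have : L - Real.log t = -Real.log t + L := by ring
  rw [this, add_pow, Finset.mul_sum]
  refine Finset.sum_congr rfl fun i _ => ?_
  rw [neg_pow (Real.log t) i]; ring

lemma main_integrable (L : ℝ) (p : ℕ) :
    IntegrableOn (fun t : ℝ => t ^ p * Real.exp (-t) * (L - Real.log t) ^ p) (Ioi 0) := by
  simp_rw [main_expand]
  exact integrable_finsetSum _ fun i _ => (int_log i p).const_mul _

lemma main_integral (L : ℝ) (p : ℕ) :
    ∫ t in Ioi (0:ℝ), t ^ p * Real.exp (-t) * (L - Real.log t) ^ p =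
    ∑ j ∈ Finset.range (p+1), ((-1 : ℝ) ^ j * (p.choose j : ℝ) * L ^ (p - j)) *
      iteratedDeriv j Real.Gamma ((p + 1 : ℕ) : ℝ) := by
  simp_rw [main_expand]
  rw [integral_finsetSum _ fun i _ => (int_log i p).const_mul _]
  simp_rw [integral_const_mul, Gamma_iter]

lemma abs_log_integrable (m p : ℕ) :
    IntegrableOn (fun t : ℝ => t ^ m * Real.exp (-t) * (1 + |Real.log t|) ^ p) (Ioi 0) := by
  have : ∀ t ∈ Ioi (0:ℝ), ∑ j ∈ Finset.range (p+1), (p.choose j : ℝ) *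
      ‖t ^ m * (Real.log t)^j * Real.exp (-t)‖ = t ^ m * Real.exp (-t) * (1 + |Real.log t|) ^ p := by
    intro t ht
    have ht : 0 < t := ht
    rw [add_comm 1, add_pow, Finset.mul_sum]
    refine Finset.sum_congr rfl fun i _ => ?_
    rw [norm_mul, norm_mul, norm_pow, norm_pow, Real.norm_of_nonneg ht.le, Real.norm_eq_abs,
      Real.norm_eq_abs, Real.abs_exp]
    ring
  refine IntegrableOn.congr_fun ?_ this measurableSet_Ioi
  exact integrable_finsetSum _ fun i _ => (int_log i m).norm.const_mul _

noncomputable def Kfun (p : ℕ) (t : ℝ) : ℝ :=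
  t ^ p * Real.exp (-t) * (1 + |Real.log t|) ^ p *
    (((p+1 : ℕ) : ℝ) * Real.exp ((p+1 : ℕ) : ℝ) * t + t ^ 2 + ((p+1 : ℕ) : ℝ)^2)

lemma Kfun_integrable (p : ℕ) : IntegrableOn (Kfun p) (Ioi 0) := by
  have h1 := (abs_log_integrable (p+1) p).const_mul (((p+1 : ℕ) : ℝ) * Real.exp ((p+1 : ℕ) : ℝ))
  have h2 := abs_log_integrable (p+2) p
  have h3 := (abs_log_integrable p p).const_mul (((p+1 : ℕ) : ℝ)^2)
  refine ((h1.add h2).add h3).congr (Eventually.of_forall fun t => ?_)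
  simp only [Kfun, Pi.add_apply]
  ring

lemma Eiota_eq (p n : ℕ) (hn : p + 1 ≤ n) :
    Eiota (p+1) n = (p.factorial : ℝ)⁻¹ * ((n.descFactorial (p+1) : ℝ) / (n:ℝ)^(p+1) *
      ∫ t in Ioi (0:ℝ), t ^ p * gcut n (n - (p+1)) t * (Real.log n - Real.log t) ^ p) := by
  have hn' : (0:ℝ) < n := by exact_mod_cast (by omega : 0 < n)
  rw [scale_integral n _ p (by omega), Eiota, if_neg (by omega), Nat.add_sub_cancel, cube_to_line]
  field_simp

lemma key_bound (p n : ℕ) (hn : p + 1 ≤ n) (hL : 1 ≤ Real.log n) :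
    |Eiota (p+1) n - (p.factorial : ℝ)⁻¹ *
      ∫ t in Ioi (0:ℝ), t ^ p * Real.exp (-t) * (Real.log n - Real.log t) ^ p| ≤
    ((p.factorial : ℝ)⁻¹ * ∫ t in Ioi (0:ℝ), Kfun p t) * ((n:ℝ)⁻¹ * (Real.log n) ^ p) := by
  have hn' : (0:ℝ) < n := by exact_mod_cast (by omega : 0 < n)
  rw [Eiota_eq p n hn, ← mul_sub, abs_mul, abs_of_nonneg (by positivity : 0 ≤ (p.factorial : ℝ)⁻¹),
    mul_assoc]
  refine mul_le_mul_of_nonneg_left ?_ (by positivity)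
  rw [← integral_const_mul, ← integral_sub ((scale_integrable n _ p (by omega)).const_mul _)
    (main_integrable _ p), ← integral_mul_const, ← Real.norm_eq_abs]
  refine norm_integral_le_of_norm_le ((Kfun_integrable p).mul_const _) ?_
  refine (ae_restrict_mem measurableSet_Ioi).mono fun t ht => ?_
  have ht : 0 < t := ht
  have hg := gcut_bound (p+1) n (by omega) hn t ht
  have hr := desc_bound (p+1) n (by omega) hn
  have hr1 : (n.descFactorial (p+1) : ℝ) / (n:ℝ)^(p+1) ≤ 1 := by
    rw [div_le_one (by positivity)]; exact_mod_cast Nat.descFactorial_le_pow n (p+1)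
  have hr0 : 0 ≤ (n.descFactorial (p+1) : ℝ) / (n:ℝ)^(p+1) := by positivity
  set ρ := (n.descFactorial (p+1) : ℝ) / (n:ℝ)^(p+1)
  set g := gcut n (n - (p+1)) t
  set L := Real.log n
  have e : ρ * (t ^ p * g * (L - Real.log t) ^ p) - t ^ p * Real.exp (-t) * (L - Real.log t)^p =
      t ^ p * (L - Real.log t)^p * (ρ * (g - Real.exp (-t)) + (ρ - 1) * Real.exp (-t)) := by ring
  have hE := Real.exp_pos (-t)
  have b1 : |ρ * (g - Real.exp (-t)) + (ρ - 1) * Real.exp (-t)| ≤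
      Real.exp (-t) * ((((p+1 : ℕ) : ℝ) * Real.exp ((p+1 : ℕ) : ℝ)) * t + t ^ 2) / n +
        ((p+1 : ℕ) : ℝ)^2 / n * Real.exp (-t) := by
    refine (abs_add_le _ _).trans (add_le_add ?_ ?_)
    · rw [abs_mul, abs_of_nonneg hr0]
      exact (mul_le_of_le_one_left (abs_nonneg _) hr1).trans hg
    · rw [abs_mul, Real.abs_exp]
      exact mul_le_mul_of_nonneg_right hr hE.le
  have b2 : |L - Real.log t| ^ p ≤ L ^ p * (1 + |Real.log t|)^p := by
    rw [← mul_pow]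
    refine pow_le_pow_left₀ (abs_nonneg _) ?_ p
    have a1 := abs_sub L (Real.log t)
    have a2 : |L| = L := abs_of_nonneg (by linarith)
    nlinarith [abs_nonneg (Real.log t)]
  rw [Real.norm_eq_abs, e, abs_mul, abs_mul, abs_pow, abs_pow, abs_of_pos ht]
  calc t ^ p * |L - Real.log t| ^ p * |ρ * (g - Real.exp (-t)) + (ρ - 1) * Real.exp (-t)|
      ≤ t ^ p * (L ^ p * (1 + |Real.log t|)^p) *
        (Real.exp (-t) * ((((p+1 : ℕ) : ℝ) * Real.exp ((p+1 : ℕ) : ℝ)) * t + t ^ 2) / n +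
        ((p+1 : ℕ) : ℝ)^2 / n * Real.exp (-t)) := by gcongr
    _ = Kfun p t * ((n:ℝ)⁻¹ * L ^ p) := by
      unfold Kfun; ring

lemma eventually_log : ∀ᶠ n : ℕ in atTop, 1 ≤ Real.log n :=
  (Real.tendsto_log_atTop.comp tendsto_natCast_atTop_atTop).eventually_ge_atTop 1

lemma main_sum (p : ℕ) (L : ℝ) (hL : L ≠ 0) :
    L ^ p * ∑ j ∈ Finset.range (p+1),
              (-1 : ℝ) ^ j * iteratedDeriv j Real.Gamma ((p + 1 : ℕ) : ℝ) /
                  ((j.factorial : ℝ) * ((p - j).factorial : ℝ)) * (L⁻¹) ^ j =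
    (p.factorial : ℝ)⁻¹ *
      ∫ t in Ioi (0:ℝ), t ^ p * Real.exp (-t) * (L - Real.log t) ^ p := by
  rw [main_integral, Finset.mul_sum, Finset.mul_sum]
  refine Finset.sum_congr rfl fun j hj => ?_
  have hj : j ≤ p := by simpa [Nat.lt_succ_iff] using hj
  rw [Nat.cast_choose ℝ hj]
  have : L ^ p = L ^ (p - j) * L ^ j := by rw [← pow_add]; congr 1; omega
  rw [this, inv_pow]
  have h1 : (p.factorial : ℝ) ≠ 0 := by positivity
  field_simp

lemma part1 (p : ℕ) : (fun n : ℕ =>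
        Eiota (p+1) n -
          (Real.log n) ^ p *
            ∑ j ∈ Finset.range (p+1),
              (-1 : ℝ) ^ j * iteratedDeriv j Real.Gamma ((p+1 : ℕ) : ℝ) /
                  ((j.factorial : ℝ) * ((p - j).factorial : ℝ)) *
                ((Real.log n)⁻¹) ^ j)
      =O[atTop] fun n : ℕ => (n : ℝ)⁻¹ * (Real.log n) ^ p := by
  refine IsBigO.of_bound ((p.factorial : ℝ)⁻¹ * ∫ t in Ioi (0:ℝ), Kfun p t) ?_
  filter_upwards [eventually_log, eventually_ge_atTop (p+1)] with n hL hn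
  rw [main_sum p _ (by positivity), Real.norm_eq_abs, Real.norm_of_nonneg (by positivity)]
  exact key_bound p n hn hL

lemma part1' (p : ℕ) : (fun n : ℕ => Eiota (p+1) n - (Real.log n) ^ p)
    =O[atTop] fun n : ℕ => (Real.log n) ^ ((p : ℤ) - 1) := by
  have h1 : (fun n : ℕ => (n : ℝ)⁻¹ * (Real.log n) ^ p) =O[atTop]
      fun n : ℕ => (Real.log n) ^ ((p : ℤ) - 1) := by
    refine IsBigO.of_bound 1 ?_
    filter_upwards [eventually_log, eventually_ge_atTop 1] with n hL hn
    have hn' : (0:ℝ) < n := by exact_mod_cast hn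
    have hL0 : 0 < Real.log n := by linarith
    rw [Real.norm_of_nonneg (by positivity), Real.norm_of_nonneg (by positivity), one_mul,
      zpow_sub_one₀ hL0.ne', zpow_natCast, mul_comm]
    have : Real.log n ≤ n := (Real.log_le_sub_one_of_pos hn').trans (by linarith)
    gcongr
  have h2 : (fun n : ℕ => ∑ j ∈ Finset.range p,
      ((-1 : ℝ) ^ (j+1) * iteratedDeriv (j+1) Real.Gamma ((p+1 : ℕ) : ℝ) /
                  (((j+1).factorial : ℝ) * ((p - (j+1)).factorial : ℝ))) *
                ((Real.log n) ^ p * ((Real.log n)⁻¹) ^ (j+1))) =O[atTop]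
      fun n : ℕ => (Real.log n) ^ ((p : ℤ) - 1) := by
    refine IsBigO.fun_sum fun j _ => IsBigO.const_mul_left ?_ _
    refine IsBigO.of_bound 1 ?_
    filter_upwards [eventually_log] with n hL
    have hL0 : 0 < Real.log n := by linarith
    rw [Real.norm_of_nonneg (by positivity), Real.norm_of_nonneg (by positivity), one_mul,
      zpow_sub_one₀ hL0.ne', zpow_natCast]
    have : (Real.log n)⁻¹ ^ (j+1) ≤ (Real.log n)⁻¹ :=
      pow_le_of_le_one (by positivity) (inv_le_one_of_one_le₀ hL) (by omega)
    gcongr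
  refine (((part1 p).trans h1).add h2).congr_left fun n => ?_
  rw [Finset.sum_range_succ', mul_add, Finset.mul_sum]
  have hG : Real.Gamma ((p+1 : ℕ) : ℝ) = p.factorial := by
    push_cast; exact Real.Gamma_nat_eq_factorial p
  have h0 : (p.factorial : ℝ) ≠ 0 := by positivity
  have : (-1 : ℝ) ^ 0 * iteratedDeriv 0 Real.Gamma ((p+1 : ℕ) : ℝ) /
                  (((0:ℕ).factorial : ℝ) * ((p - 0).factorial : ℝ)) *
                ((Real.log n)⁻¹) ^ 0 = 1 := by
    rw [iteratedDeriv_zero, hG]; simp [h0]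
  rw [this]
  have : ∀ j, Real.log n ^ p * ((-1 : ℝ) ^ (j+1) * iteratedDeriv (j+1) Real.Gamma ((p+1 : ℕ) : ℝ) /
                  (((j+1).factorial : ℝ) * ((p - (j+1)).factorial : ℝ)) *
                ((Real.log n)⁻¹) ^ (j+1)) =
      ((-1 : ℝ) ^ (j+1) * iteratedDeriv (j+1) Real.Gamma ((p+1 : ℕ) : ℝ) /
                  (((j+1).factorial : ℝ) * ((p - (j+1)).factorial : ℝ))) *
                ((Real.log n) ^ p * ((Real.log n)⁻¹) ^ (j+1)) := fun j => by ring
  simp_rw [this]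
  ring

lemma log_zpow_mono (a b : ℤ) (hab : a ≤ b) : (fun n : ℕ => (Real.log n) ^ a) =O[atTop]
    fun n : ℕ => (Real.log n) ^ b := by
  refine IsBigO.of_bound 1 ?_
  filter_upwards [eventually_log] with n hL
  have hL0 : 0 < Real.log n := by linarith
  rw [Real.norm_of_nonneg (by positivity), Real.norm_of_nonneg (by positivity), one_mul]
  exact zpow_le_zpow_right₀ hL hab

lemma Eiota_lower (k : ℕ) (q : ℤ) (hk : (k:ℤ) - 1 ≤ q) : (fun n : ℕ => Eiota k n) =O[atTop]
    fun n : ℕ => (Real.log n) ^ q := by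
  rcases k with _ | p
  · have : (fun n : ℕ => Eiota 0 n) =ᶠ[atTop] fun _ => 0 := by
      filter_upwards [eventually_ge_atTop 1] with n hn
      rw [Eiota, if_pos rfl, if_neg (by omega)]
    exact this.trans_isBigO (isBigO_zero _ _)
  · push_cast at hk
    have h1 := (part1' p).trans (log_zpow_mono _ q (by linarith))
    have h2 := log_zpow_mono p q (by linarith)
    simp_rw [zpow_natCast] at h2
    exact (h1.add h2).congr_left fun n => by ring

theorem stmt13 (d : ℕ) (hd : 1 ≤ d) :
    ((fun n : ℕ =>
        Eiota d n -
          (Real.log n) ^ (d - 1) *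
            ∑ j ∈ Finset.range d,
              (-1 : ℝ) ^ j * iteratedDeriv j Real.Gamma (d : ℝ) /
                  ((j.factorial : ℝ) * ((d - 1 - j).factorial : ℝ)) *
                ((Real.log n)⁻¹) ^ j)
      =O[atTop] fun n : ℕ => (n : ℝ)⁻¹ * (Real.log n) ^ (d - 1)) ∧
      (fun n : ℕ => Egamma d n - (Real.log n) ^ (d - 1))
        =O[atTop] fun n : ℕ => (Real.log n) ^ ((d : ℤ) - 2) := by
  obtain ⟨p, rfl⟩ : ∃ p, d = p + 1 := ⟨d - 1, by omega⟩
  refine ⟨by simpa only [Nat.add_sub_cancel] using part1 p, ?_⟩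
  have e : (((p+1 : ℕ) : ℤ) - 2) = (p:ℤ) - 1 := by push_cast; ring
  rw [e, Nat.add_sub_cancel]
  have h2 : (fun n : ℕ => ∑ k ∈ Finset.range (p + 1), ((p+1).choose k : ℝ) * Eiota k n) =O[atTop]
      fun n : ℕ => (Real.log n) ^ ((p:ℤ) - 1) := by
    refine IsBigO.fun_sum fun k hk => IsBigO.const_mul_left (Eiota_lower k _ ?_) _
    have := Finset.mem_range.1 hk
    omega
  refine ((part1' p).add h2).congr_left fun n => ?_
  rw [Egamma, Finset.sum_range_succ _ (p+1), Nat.choose_self]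
  push_cast
  ring
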